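/- arXiv:1707.09004 — 10 statements merged into one kernel-verified Lean document; each statement's English description precedes it below -/
import Mathlib

section
/- Suppose (S,*) is a hermitian discrete hypergroup, i.e., conv is associative and, for all m,n ∈ S, e ∈ supp(conv(m,n)) if and only if m = n. Then: (i) either S is finite or (S,≤) is order-isomorphic to (ℕ,≤); (ii) for every n ∈ S\{e}, 𝓛_n ⊆ Q_n ⊆ 𝓛_n ∪ {n}; (iii) if S has more than 2 elements, then for all m,n ∈ S with e ≠ m < n one has q_n(e) = q_n(m)·q_m(e) and q_n(e)·(1 + ∑_{k ∈ 𝓛_n, k ≠ e} 1/q_k(e)) ≤ 1. -/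
/-- Associativity at `(m, n, n)` with `m < n` says that translating `q n` by `m` leaves it fixed. -/
lemma finsum_mul_conv_eq_of_lt {S : Type*} [LinearOrder S] {q : S → S → ℝ}
    {conv : S → S → S → ℝ} {m n : S}
    (hdiag : conv n n = q n)
    (hoff : ∀ j, conv m n j = if j = max m n then 1 else 0)
    (hassoc : ∀ t, ∑ᶠ j, conv m n j * conv j n t = ∑ᶠ j, conv n n j * conv m j t)
    (hmn : m < n) (t : S) : ∑ᶠ j, q n j * conv m j t = q n t := by
  have h := hassoc t
  rw [hdiag, finsum_eq_single _ n fun j hj => by simp [hoff, max_eq_right hmn.le, hj], hoff,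
    max_eq_right hmn.le, if_pos rfl, one_mul, hdiag] at h
  exact h.symm

/-- An infinite linear order with a least element and finite initial segments is a copy of `ℕ`. -/
lemma nonempty_orderIso_nat_of_finite_Iio {S : Type*} [LinearOrder S] [Infinite S]
    (e : S) (he : ∀ s, e ≤ s) (hfin : ∀ n : S, (Set.Iio n).Finite) : Nonempty (S ≃o ℕ) := by
  let : OrderBot S := { bot := e, bot_le := he }
  let : LocallyFiniteOrder S := LocallyFiniteOrder.ofFiniteIcc fun a b =>
    ((hfin b).insert b).subset fun x hx => by
      rcases hx.2.eq_or_lt with h | h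
      · exact Or.inl h
      · exact Or.inr h
  have : NoMaxOrder S := ⟨fun a => by
    by_contra! h
    exact Set.infinite_univ (((hfin a).insert a).subset fun x _ =>
      (h x).eq_or_lt.imp id id)⟩
  let : SuccOrder S := LinearLocallyFiniteOrder.succOrder S
  let : PredOrder S := LinearLocallyFiniteOrder.predOrder S
  exact ⟨orderIsoNatOfLinearSuccPredArch⟩


/-- Theorem 3.2, necessity: Let `(S, ≤)` be a linearly ordered set with least element
`e`, viewed as a "max" semigroup. Deform the product on the diagonal off `e` by
probability measures `q n` (finitely supported, nonnegative, total mass `1`, with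
`q n e > 0`), giving the convolution `conv`. If `(S, conv)` is a hermitian discrete
hypergroup (i.e. `conv` is associative and `e ∈ supp (conv m n) ↔ m = n`), then:
(i) `S` is finite or order-isomorphic to `ℕ`;
(ii) for `n ≠ e`, `𝓛ₙ ⊆ Qₙ ⊆ 𝓛ₙ ∪ {n}`;
(iii) if `S` has more than two elements then for `e ≠ m < n` one has
`q n e = q n m * q m e` and `q n e * (1 + ∑_{e ≠ k < n} 1 / q k e) ≤ 1`. -/
theorem maxSemigroup_deformation_necessary {S : Type*} [LinearOrder S]
    (e : S) (he : ∀ s : S, e ≤ s)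
    (q : S → S → ℝ)
    (hq_fin : ∀ n : S, n ≠ e → {j : S | q n j ≠ 0}.Finite)
    (hq_nonneg : ∀ n : S, n ≠ e → ∀ j, 0 ≤ q n j)
    (hq_sum : ∀ n : S, n ≠ e → ∑ᶠ j, q n j = 1)
    (hq_e : ∀ n : S, n ≠ e → 0 < q n e)
    (conv : S → S → S → ℝ)
    (hconv_diag : ∀ n : S, n ≠ e → conv n n = q n)
    (hconv_off : ∀ m n : S, (m ≠ n ∨ (m = e ∧ n = e)) →
      ∀ j, conv m n j = if j = max m n then 1 else 0)
    (hassoc : ∀ m n k t : S,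
      ∑ᶠ j, conv m n j * conv j k t = ∑ᶠ j, conv n k j * conv m j t)
    (hsupp : ∀ m n : S, conv m n e ≠ 0 ↔ m = n) :
    ((Set.univ : Set S).Finite ∨ Nonempty (S ≃o ℕ)) ∧
    (∀ n : S, n ≠ e → (∀ k, k < n → q n k ≠ 0) ∧ (∀ j, q n j ≠ 0 → j ≤ n)) ∧
    ((∃ a b c : S, a ≠ b ∧ b ≠ c ∧ a ≠ c) →
      ∀ m n : S, m ≠ e → m < n →
        q n e = q n m * q m e ∧
        q n e * (1 + ∑ᶠ k ∈ {k : S | k < n ∧ k ≠ e}, 1 / q k e) ≤ 1) := by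
  have key : ∀ m n : S, m < n → ∀ t, ∑ᶠ j, q n j * conv m j t = q n t := fun m n hmn =>
    finsum_mul_conv_eq_of_lt (hconv_diag n ((he m).trans_lt hmn).ne')
      (hconv_off m n (Or.inl hmn.ne)) (hassoc m n n) hmn
  have hmul : ∀ m n : S, m ≠ e → m < n → q n e = q n m * q m e := by
    intro m n hm hmn
    rw [← key m n hmn e, finsum_eq_single _ m, hconv_diag m hm]
    intro j hj
    rw [not_not.1 (mt (hsupp m j).1 hj.symm), mul_zero]
  have hlow : ∀ n : S, n ≠ e → ∀ k, k < n → q n k ≠ 0 := by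
    intro n hn k hk h0
    have hpos := hq_e n hn
    rcases eq_or_ne k e with rfl | hke
    · exact hpos.ne' h0
    · rw [hmul k n hke hk, h0, zero_mul] at hpos
      exact hpos.false
  have hup : ∀ n : S, n ≠ e → ∀ j, q n j ≠ 0 → j ≤ n := by
    intro m hm t ht
    by_contra! hmt
    have hk := key m t hmt t
    rw [finsum_eq_sum_of_support_subset (s := {t, m}), Finset.sum_pair hmt.ne',
      hconv_off m t (Or.inl hmt.ne), max_eq_right hmt.le, if_pos rfl, mul_one,
      hconv_diag m hm, add_eq_left] at hk
    · exact (mul_ne_zero (hlow t ((he m).trans_lt hmt).ne' m hmt) ht) hk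
    · intro j hj
      by_contra! hj'
      simp only [Finset.coe_insert, Finset.coe_singleton, Set.mem_insert_iff,
        Set.mem_singleton_iff, not_or] at hj'
      apply hj
      have : t ≠ max m j := by
        rcases max_choice m j with h | h <;> rw [h]
        exacts [hmt.ne', Ne.symm hj'.1]
      simp only [hconv_off m j (Or.inl (Ne.symm hj'.2)), if_neg this, mul_zero]
  have hfin : ∀ n : S, (Set.Iio n).Finite := by
    intro n
    rcases eq_or_ne n e with rfl | hn
    · exact Set.finite_empty.subset fun x hx => absurd hx (he x).not_gt
    · exact (hq_fin n hn).subset fun k hk => hlow n hn k hk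
  refine ⟨?_, fun n hn => ⟨hlow n hn, hup n hn⟩, fun _ m n hm hmn => ⟨hmul m n hm hmn, ?_⟩⟩
  · rcases finite_or_infinite S with h | h
    · exact Or.inl Set.finite_univ
    · exact Or.inr (nonempty_orderIso_nat_of_finite_Iio e he hfin)
  · have hn : n ≠ e := ((he m).trans_lt hmn).ne'
    have hA : {k : S | k < n ∧ k ≠ e}.Finite := (hfin n).subset fun k hk => hk.1
    have hterm : ∀ k ∈ hA.toFinset, q n e * (1 / q k e) = q n k := by
      intro k hk
      obtain ⟨hkn, hke⟩ := hA.mem_toFinset.1 hk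
      rw [hmul k n hke hkn, mul_one_div, mul_div_cancel_right₀ _ (hq_e k hke).ne']
    have he_notMem : e ∉ hA.toFinset := fun h => (hA.mem_toFinset.1 h).2 rfl
    rw [finsum_mem_eq_finite_toFinset_sum _ hA, mul_add, mul_one, Finset.mul_sum,
      Finset.sum_congr rfl hterm, ← Finset.sum_insert he_notMem, ← hq_sum n hn,
      finsum_eq_sum_of_support_subset (s := (hq_fin n hn).toFinset) (q n)
        (hq_fin n hn).coe_toFinset.ge]
    refine Finset.sum_le_sum_of_subset_of_nonneg (fun k hk => ?_) fun j _ _ => hq_nonneg n hn j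
    rw [Set.Finite.mem_toFinset]
    rcases Finset.mem_insert.1 hk with rfl | hk
    · exact (hq_e n hn).ne'
    · exact hlow n hn k (hA.mem_toFinset.1 hk).1
end

section
/- Assume: (i) either S is finite or (S,≤) is order-isomorphic to (ℕ,≤); (ii) for every n ∈ S\{e}, 𝓛_n ⊆ Q_n ⊆ 𝓛_n ∪ {n}; (iii) if S has more than 2 elements, then for all m,n ∈ S with e ≠ m < n one has q_n(e) = q_n(m)·q_m(e) and q_n(e)·(1 + ∑_{k ∈ 𝓛_n, k ≠ e} 1/q_k(e)) ≤ 1. Then (S,*) is a hermitian discrete hypergroup, i.e., conv is associative and, for all m,n ∈ S, e ∈ supp(conv(m,n)) if and only if m = n. -/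
/-- Summing the Dirac function at `p` against `f` evaluates `f` at `p`. -/
theorem finsum_dirac_mul {S : Type*} [DecidableEq S] (p : S) (d f : S → ℝ)
    (hd : ∀ j, d j = if j = p then 1 else 0) : ∑ᶠ j, d j * f j = f p := by
  rw [finsum_eq_single _ p (fun j hj => by simp [hd, hj])]
  simp [hd]

/-- Let `c j` be the product of the points `j` and `m` in a deformed max semigroup, with diagonal
value `c m = b`. If `a t = a m * b t` for all `t < m`, then multiplying `a` by the point `m`
leaves `a` unchanged. -/
theorem finsum_mul_conv_of_absorb {S : Type*} [LinearOrder S] (a b : S → ℝ) (m : S)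
    (c : S → S → ℝ)
    (hb_supp : ∀ j, b j ≠ 0 → j ≤ m) (hb_sum : ∑ᶠ j, b j = 1)
    (hab : ∀ t, t < m → a t = a m * b t)
    (hc_diag : c m = b)
    (hc_off : ∀ j, j ≠ m → ∀ t, c j t = if t = max j m then 1 else 0) (t : S) :
    ∑ᶠ j, a j * c j t = a t := by
  have hb_zero : ∀ j, m < j → b j = 0 := fun j hj => by
    by_contra h
    exact absurd (hb_supp j h) (not_le.2 hj)
  rcases lt_trichotomy t m with ht | rfl | ht
  · rw [finsum_eq_single _ m, hc_diag, hab t ht]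
    intro j hj
    rw [hc_off j hj, if_neg (ne_of_lt (lt_of_lt_of_le ht (le_max_right _ _))), mul_zero]
  · have hterm : ∀ j, a j * c j t = a t * b j := by
      intro j
      rcases lt_trichotomy j t with hj | rfl | hj
      · rw [hc_off j hj.ne, if_pos (max_eq_right hj.le).symm, mul_one, hab j hj]
      · rw [hc_diag]
      · rw [hc_off j hj.ne', hb_zero j hj, max_eq_left hj.le, if_neg hj.ne]
        simp
    have hfin : b.support.Finite := by
      by_contra h
      rw [finsum_of_infinite_support h] at hb_sum
      exact zero_ne_one hb_sum
    rw [finsum_congr hterm, ← mul_finsum' _ _ hfin, hb_sum, mul_one]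
  · rw [finsum_eq_single _ t]
    · rw [hc_off t ht.ne', if_pos (max_eq_left ht.le).symm, mul_one]
    · intro j hj
      rcases eq_or_ne j m with rfl | hjm
      · rw [hc_diag, hb_zero t ht, mul_zero]
      · rw [hc_off j hjm, if_neg, mul_zero]
        intro h
        rcases max_choice j m with h' | h' <;> rw [h'] at h
        · exact hj h.symm
        · exact ht.ne' h


/-- Theorem 3.2, sufficiency: Let `(S, ≤)` be a linearly ordered set with least element
`e`, viewed as a "max" semigroup, with diagonal deformation by probability measures
`q n` (`n ≠ e`) giving the convolution `conv`. Assume: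
(i) `S` is finite or order-isomorphic to `ℕ`;
(ii) for `n ≠ e`, `𝓛ₙ ⊆ Qₙ ⊆ 𝓛ₙ ∪ {n}`;
(iii) if `S` has more than two elements then for `e ≠ m < n` one has
`q n e = q n m * q m e` and `q n e * (1 + ∑_{e ≠ k < n} 1 / q k e) ≤ 1`.
Then `(S, conv)` is a hermitian discrete hypergroup, i.e. `conv` is associative and
`e ∈ supp (conv m n) ↔ m = n`. -/
theorem maxSemigroup_deformation_sufficient {S : Type*} [LinearOrder S]
    (e : S) (he : ∀ s : S, e ≤ s)
    (q : S → S → ℝ)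
    (hq_fin : ∀ n : S, n ≠ e → {j : S | q n j ≠ 0}.Finite)
    (hq_nonneg : ∀ n : S, n ≠ e → ∀ j, 0 ≤ q n j)
    (hq_sum : ∀ n : S, n ≠ e → ∑ᶠ j, q n j = 1)
    (hq_e : ∀ n : S, n ≠ e → 0 < q n e)
    (conv : S → S → S → ℝ)
    (hconv_diag : ∀ n : S, n ≠ e → conv n n = q n)
    (hconv_off : ∀ m n : S, (m ≠ n ∨ (m = e ∧ n = e)) →
      ∀ j, conv m n j = if j = max m n then 1 else 0)
    (h1 : (Set.univ : Set S).Finite ∨ Nonempty (S ≃o ℕ))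
    (h2 : ∀ n : S, n ≠ e → (∀ k, k < n → q n k ≠ 0) ∧ (∀ j, q n j ≠ 0 → j ≤ n))
    (h3 : (∃ a b c : S, a ≠ b ∧ b ≠ c ∧ a ≠ c) →
      ∀ m n : S, m ≠ e → m < n →
        q n e = q n m * q m e ∧
        q n e * (1 + ∑ᶠ k ∈ {k : S | k < n ∧ k ≠ e}, 1 / q k e) ≤ 1) :
    (∀ m n k t : S,
      ∑ᶠ j, conv m n j * conv j k t = ∑ᶠ j, conv n k j * conv m j t) ∧
    (∀ m n : S, conv m n e ≠ 0 ↔ m = n) := by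
  have hcomm : ∀ m n, conv m n = conv n m := by
    intro m n
    rcases eq_or_ne m n with rfl | hmn
    · rfl
    · funext j
      rw [hconv_off m n (.inl hmn), hconv_off n m (.inl hmn.symm), max_comm]
  have hconv_e : ∀ n j, conv n e j = if j = n then 1 else 0 := by
    intro n j
    rw [hconv_off n e (by tauto), max_eq_left (he n)]
  have hsupp : ∀ m n j, conv m n j ≠ 0 → j ≤ max m n := by
    intro m n j hj
    by_cases h : m ≠ n ∨ (m = e ∧ n = e)
    · rw [hconv_off m n h] at hj
      exact (by simpa using hj : j = max m n).le
    · obtain ⟨rfl, hne⟩ : m = n ∧ m ≠ e := by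
        have : m = n := by tauto
        subst this
        tauto
      rw [hconv_diag m hne] at hj
      simpa using (h2 m hne).2 j hj
  have hsum : ∀ m n, ∑ᶠ j, conv m n j = 1 := by
    intro m n
    by_cases h : m ≠ n ∨ (m = e ∧ n = e)
    · simpa using finsum_dirac_mul (max m n) (conv m n) (fun _ => 1) (hconv_off m n h)
    · obtain ⟨rfl, hne⟩ : m = n ∧ m ≠ e := by
        have : m = n := by tauto
        subst this
        tauto
      rw [hconv_diag m hne, hq_sum m hne]
  have hfin : ∀ m n, (conv m n).support.Finite := by
    intro m n
    by_contra h
    have := hsum m n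
    rw [finsum_of_infinite_support h] at this
    exact zero_ne_one this
  have hoff : ∀ m n, m ≠ n → ∀ f : S → ℝ, ∑ᶠ j, conv m n j * f j = f (max m n) :=
    fun m n hmn f => finsum_dirac_mul _ _ f (hconv_off m n (.inl hmn))
  have habsorb : ∀ m n, m ≠ e → m < n → ∀ t, t < m → q n t = q n m * q m t := by
    intro m n hm hmn t ht
    have h3' := h3 ⟨e, m, n, hm.symm, hmn.ne, ((he m).trans_lt hmn).ne⟩
    rcases eq_or_ne t e with rfl | hte
    · exact (h3' m n hm hmn).1
    · refine mul_right_cancel₀ (hq_e t hte).ne' ?_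
      rw [← (h3' t n hte (ht.trans hmn)).1, mul_assoc, ← (h3' t m hte ht).1,
        ← (h3' m n hm hmn).1]
  have hswap : ∀ m n k, m < k → ∀ t,
      ∑ᶠ j, conv m n j * conv j k t = ∑ᶠ j, conv k n j * conv j m t := by
    intro m n k hmk t
    rcases lt_trichotomy n k with hnk | rfl | hkn
    · have hterm : ∀ j, conv m n j * conv j k t = conv m n j * if t = k then 1 else 0 := by
        intro j
        by_cases hj : conv m n j = 0
        · simp [hj]
        · have hjk : j < k := (hsupp m n j hj).trans_lt (max_lt hmk hnk)
          rw [hconv_off j k (.inl hjk.ne), max_eq_right hjk.le]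
      rw [finsum_congr hterm, ← finsum_mul' _ _ (hfin m n), hsum, one_mul, hoff k n hnk.ne',
        max_eq_left hnk.le, hconv_off k m (.inl hmk.ne'), max_eq_left hmk.le]
    · have hne : n ≠ e := ((he m).trans_lt hmk).ne'
      rw [hoff m n hmk.ne, max_eq_right hmk.le, hconv_diag n hne]
      symm
      rcases eq_or_ne m e with rfl | hm
      · rw [finsum_eq_single _ t (fun j hj => by rw [hconv_e, if_neg hj.symm, mul_zero]),
          hconv_e, if_pos rfl, mul_one]
      · exact finsum_mul_conv_of_absorb (q n) (q m) m (fun j => conv j m) (h2 m hm).2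
          (hq_sum m hm) (habsorb m n hm hmk) (hconv_diag m hm)
          (fun j hj => hconv_off j m (.inl hj)) t
    · have hmn := hmk.trans hkn
      rw [hoff m n hmn.ne, hoff k n hkn.ne, max_eq_right hmn.le, max_eq_right hkn.le,
        hconv_off n k (.inl hkn.ne'), hconv_off n m (.inl hmn.ne'), max_eq_left hkn.le,
        max_eq_left hmn.le]
  refine ⟨fun m n k t => ?_, fun m n => ⟨fun h => ?_, ?_⟩⟩
  · have hrhs : ∑ᶠ j, conv n k j * conv m j t = ∑ᶠ j, conv k n j * conv j m t :=
      finsum_congr fun j => by rw [hcomm n k, hcomm m j]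
    rw [hrhs]
    rcases lt_trichotomy m k with hmk | rfl | hkm
    · exact hswap m n k hmk t
    · rfl
    · exact (hswap k n m hkm t).symm
  · by_contra hmn
    rw [hconv_off m n (.inl hmn)] at h
    have hmax : e = max m n := by simpa using h
    have hm : m = e := le_antisymm (hmax ▸ le_max_left m n) (he m)
    have hn : n = e := le_antisymm (hmax ▸ le_max_right m n) (he n)
    exact hmn (hm.trans hn.symm)
  · rintro rfl
    rcases eq_or_ne m e with rfl | hm
    · simp [hconv_e]
    · rw [hconv_diag m hm]
      exact (hq_e m hm).ne'
end

section
/- The convolution conv_v satisfies: (1) each conv_v(n,n) (n ≥ 1) has nonnegative entries summing to 1; (2) conv_v is associative, i.e., ∑_j conv_v(m,n)(j)·conv_v(j,k) = ∑_j conv_v(n,k)(j)·conv_v(m,j) for all m,n,k ∈ ℕ; (3) for all m,n ∈ ℕ, 0 ∈ supp(conv_v(m,n)) if and only if m = n; (4) for n ≥ 1, supp(conv_v(n,n)) = {0,1,…,n−1} if v(n) = ∑_{j<n} v(j), and supp(conv_v(n,n)) = {0,1,…,n} if v(n) > ∑_{j<n} v(j). Moreover, conv_v is the unique such associative deformation: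 if q_n (n ≥ 1) are finitely supported probability functions on ℕ with q_n(0) = 1/v(n) > 0, and the convolution defined by δ_{max(m,n)} off the nonzero diagonal and q_n on it is associative and satisfies 0 ∈ supp of the convolution of m and n iff m = n, then q_n = conv_v(n,n) for all n ≥ 1. -/
/-- The deformed convolution `conv_v` on `ℕ` associated to a weight sequence `v`:
`conv_v m n = δ_{max m n}` when `m ≠ n` or `m = n = 0`, and for `n ≥ 1`,
`conv_v n n` has mass `v j / v n` at `j < n`, mass `(v n − ∑_{j<n} v j)/v n` at `n`,
and `0` above `n`. -/
noncomputable def convv (v : ℕ → ℝ) (m n j : ℕ) : ℝ :=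
  if m = n ∧ n ≠ 0 then
    (if j < n then v j / v n
     else if j = n then (v n - ∑ i ∈ Finset.range n, v i) / v n
     else 0)
  else if j = max m n then 1 else 0

theorem convv_comm (v : ℕ → ℝ) (m n : ℕ) : convv v m n = convv v n m := by
  by_cases h : m = n
  · rw [h]
  · ext j
    simp [convv, h, Ne.symm h, max_comm]

theorem convv_of_ne (v : ℕ → ℝ) {m n : ℕ} (h : m ≠ n) (j : ℕ) :
    convv v m n j = if j = max m n then 1 else 0 := by
  simp [convv, h]

theorem convv_zero_left (v : ℕ → ℝ) (n j : ℕ) :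
    convv v 0 n j = if j = n then 1 else 0 := by
  rcases eq_or_ne n 0 with rfl | h
  · simp [convv]
  · simp [convv, h, h.symm]

theorem convv_self_of_lt (v : ℕ → ℝ) {n j : ℕ} (h : j < n) : convv v n n j = v j / v n := by
  simp [convv, h, Nat.ne_zero_of_lt h]

theorem convv_self_of_gt (v : ℕ → ℝ) {n j : ℕ} (h : n < j) : convv v n n j = 0 := by
  simp [convv, h.not_gt, h.ne']

theorem convv_self_self {v : ℕ → ℝ} (hv0 : v 0 = 1) (n : ℕ) :
    convv v n n n = (v n - ∑ i ∈ Finset.range n, v i) / v n := by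
  rcases eq_or_ne n 0 with rfl | h
  · simp [convv, hv0]
  · simp [convv, h]

theorem sum_range_convv_self_of_le (v : ℕ → ℝ) {n k : ℕ} (h : k ≤ n) :
    ∑ j ∈ Finset.range k, convv v n n j = (∑ j ∈ Finset.range k, v j) / v n := by
  rw [Finset.sum_div]
  exact Finset.sum_congr rfl fun j hj =>
    convv_self_of_lt v ((Finset.mem_range.1 hj).trans_le h)

theorem finsum_convv_self {v : ℕ → ℝ} (hv0 : v 0 = 1) {n : ℕ} (hn : v n ≠ 0) :
    ∑ᶠ j, convv v n n j = 1 := by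
  rw [finsum_eq_sum_of_support_subset (s := Finset.range (n + 1)), Finset.sum_range_succ,
    sum_range_convv_self_of_le v le_rfl, convv_self_self hv0]
  · field_simp
    ring
  · intro j hj
    by_contra h
    exact hj (convv_self_of_gt v (by simpa using h))

theorem finsum_convv_of_ne (v : ℕ → ℝ) {m n : ℕ} (h : m ≠ n ∨ n = 0) (f : ℕ → ℝ) :
    ∑ᶠ j, convv v m n j * f j = f (max m n) := by
  have hc (j : ℕ) : convv v m n j = if j = max m n then 1 else 0 := by
    rcases h with h | rfl
    · exact convv_of_ne v h j
    · rw [convv_comm, convv_zero_left]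
      simp
  rw [finsum_eq_single _ (max m n) fun j hj => by simp [hc, hj]]
  simp [hc]

/-- The associativity identity for the triple `(n, n, k)`, with its right-hand side evaluated. -/
theorem finsum_convv_self_mul {v : ℕ → ℝ} (hv0 : v 0 = 1) (hv : ∀ n, v n ≠ 0) {n k : ℕ}
    (hk : k ≠ n) (t : ℕ) :
    ∑ᶠ j, convv v n n j * convv v j k t = convv v (max k n) n t := by
  rcases lt_trichotomy t k with ht | rfl | ht
  · rw [finsum_eq_single _ k fun j hj => by
      rw [convv_of_ne v hj, if_neg (by omega), mul_zero], convv_self_of_lt v ht]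
    rcases hk.lt_or_gt with h | h
    · rw [max_eq_right h.le, convv_self_of_lt v h, convv_self_of_lt v (ht.trans h)]
      field_simp [hv k]
    · rw [max_eq_left h.le, convv_self_of_gt v h, convv_of_ne v hk, if_neg (by omega), zero_mul]
  · rcases hk.lt_or_gt with h | h
    · rw [finsum_eq_sum_of_support_subset (s := Finset.range (t + 1)), Finset.sum_range_succ,
        Finset.sum_congr rfl (g := fun j => convv v n n j),
        sum_range_convv_self_of_le v h.le, convv_self_self hv0, max_eq_right h.le,
        convv_self_of_lt v h]
      · field_simp [hv t]
        ring
      · intro j hj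
        have hj := Finset.mem_range.1 hj
        rw [convv_of_ne v hj.ne, if_pos (by omega), mul_one]
      · intro j hj
        by_contra hjt
        have hjt : t < j := by simpa using hjt
        exact hj (by simp only [convv_of_ne v hjt.ne', if_neg (show t ≠ max j t by omega), mul_zero])
    · rw [max_eq_left h.le, convv_of_ne v hk, if_pos (by omega), ← finsum_convv_self hv0 (hv n)]
      refine finsum_congr fun j => ?_
      rcases lt_or_ge n j with hj | hj
      · simp [convv_self_of_gt v hj]
      · rw [convv_of_ne v (by omega : j ≠ t), if_pos (by omega), mul_one]
  · rw [finsum_eq_single _ t fun j hj => by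
      rcases eq_or_ne j k with rfl | hjk
      · rw [convv_self_of_gt v ht, mul_zero]
      · rw [convv_of_ne v hjk, if_neg (by omega), mul_zero],
      convv_of_ne v ht.ne', if_pos (by omega), mul_one]
    rcases hk.lt_or_gt with h | h
    · rw [max_eq_right h.le]
    · rw [max_eq_left h.le, convv_self_of_gt v (h.trans ht), convv_of_ne v hk, if_neg (by omega)]

theorem convv_assoc {v : ℕ → ℝ} (hv0 : v 0 = 1) (hv : ∀ n, v n ≠ 0) (m n k t : ℕ) :
    ∑ᶠ j, convv v m n j * convv v j k t = ∑ᶠ j, convv v n k j * convv v m j t := by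
  rw [finsum_congr fun j => show convv v n k j * convv v m j t = convv v k n j * convv v j m t by
    rw [convv_comm v n k, convv_comm v m j]]
  rcases eq_or_ne m k with rfl | hmk
  · rfl
  rcases eq_or_ne m n with rfl | hmn
  · rw [finsum_convv_self_mul hv0 hv hmk.symm,
      finsum_convv_of_ne v (.inl hmk.symm) fun j => convv v j m t]
  rcases eq_or_ne k n with rfl | hkn
  · rw [finsum_convv_self_mul hv0 hv hmk,
      finsum_convv_of_ne v (.inl hmk) fun j => convv v j k t]
  rw [finsum_convv_of_ne v (.inl hmn) fun j => convv v j k t,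
    finsum_convv_of_ne v (.inl hkn) fun j => convv v j m t,
    convv_of_ne v (by omega), convv_of_ne v (by omega)]
  congr 2
  omega

theorem convv_self_nonneg {v : ℕ → ℝ} (hv : ∀ n, 0 < v n) {n : ℕ}
    (hn : ∑ j ∈ Finset.range n, v j ≤ v n) (j : ℕ) : 0 ≤ convv v n n j := by
  have hvj := (hv j).le
  have hvn := (hv n).le
  have hsub := sub_nonneg.2 hn
  unfold convv
  split_ifs <;> positivity

theorem convv_apply_zero_ne_zero_iff {v : ℕ → ℝ} (hv0 : v 0 = 1) (hv : ∀ n, v n ≠ 0) (m n : ℕ) :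
    convv v m n 0 ≠ 0 ↔ m = n := by
  rcases eq_or_ne m n with rfl | h
  · rcases eq_or_ne m 0 with rfl | hm
    · simp [convv]
    · simp [convv_self_of_lt v (Nat.pos_of_ne_zero hm), hv0, hv m]
  · simp only [convv_of_ne v h, h, iff_false, not_not]
    exact if_neg (by omega)

theorem convv_self_ne_zero_iff {v : ℕ → ℝ} (hv0 : v 0 = 1) (hv : ∀ n, v n ≠ 0) (n j : ℕ) :
    convv v n n j ≠ 0 ↔ j < n ∨ j = n ∧ v n ≠ ∑ i ∈ Finset.range n, v i := by
  rcases lt_trichotomy j n with h | rfl | h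
  · simp [convv_self_of_lt v h, hv, h]
  · simp [convv_self_self hv0, hv, sub_eq_zero]
  · simp [convv_self_of_gt v h, h.not_gt, h.ne']

/-- An associative deformation of `(ℕ, max)` is determined by its values at `0`. -/
theorem eq_convv_of_assoc {v : ℕ → ℝ} (hv0 : v 0 = 1) (hv : ∀ n, v n ≠ 0) {q : ℕ → ℕ → ℝ}
    (hq1 : ∀ n : ℕ, 1 ≤ n → ∑ᶠ j, q n j = 1) (hq0 : ∀ n : ℕ, 1 ≤ n → q n 0 = 1 / v n)
    {conv : ℕ → ℕ → ℕ → ℝ} (hdiag : ∀ n : ℕ, 1 ≤ n → conv n n = q n)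
    (hoff : ∀ m n : ℕ, (m ≠ n ∨ n = 0) → ∀ j, conv m n j = if j = max m n then 1 else 0)
    (hassoc : ∀ m n k t : ℕ,
      ∑ᶠ j, conv m n j * conv j k t = ∑ᶠ j, conv n k j * conv m j t)
    {n : ℕ} (hn : 1 ≤ n) : q n = convv v n n := by
  have hmul (k : ℕ) (hk : 1 ≤ k) (hkn : k ≠ n) : q n k * q k 0 = conv n (max n k) 0 := by
    have h := hassoc n n k 0
    rwa [finsum_eq_single _ k fun j hj => by rw [hoff j k (.inl hj), if_neg (by omega), mul_zero],
      finsum_eq_single _ (max n k) fun j hj => by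
        rw [hoff n k (.inl hkn.symm), if_neg hj, zero_mul],
      hoff n k (.inl hkn.symm), if_pos rfl, one_mul, hdiag n hn, hdiag k hk] at h
  have hlt (k : ℕ) (hk : k < n) : q n k = v k / v n := by
    rcases Nat.eq_zero_or_pos k with rfl | hk0
    · rw [hq0 n hn, hv0]
    · have h := hmul k hk0 hk.ne
      rw [max_eq_left hk.le, hdiag n hn, hq0 n hn, hq0 k hk0] at h
      field_simp [hv k, hv n] at h ⊢
      linarith
  have hgt (k : ℕ) (hk : n < k) : q n k = 0 := by
    have h := hmul k (hn.trans hk.le) hk.ne'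
    rw [max_eq_right hk.le, hoff n k (.inl hk.ne), if_neg (by omega),
      hq0 k (hn.trans hk.le)] at h
    simpa [hv k] using h
  have hself : q n n = (v n - ∑ i ∈ Finset.range n, v i) / v n := by
    have h := hq1 n hn
    rw [finsum_eq_sum_of_support_subset (s := Finset.range (n + 1)), Finset.sum_range_succ,
      Finset.sum_congr rfl (g := fun j => v j / v n) fun j hj => hlt j (Finset.mem_range.1 hj),
      ← Finset.sum_div] at h
    · rw [sub_div, div_self (hv n)]
      linarith
    · intro j hj
      by_contra hjn
      exact hj (hgt j (by simpa using hjn))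
  ext j
  rcases lt_trichotomy j n with h | rfl | h
  · rw [hlt j h, convv_self_of_lt v h]
  · rw [hself, convv_self_self hv0]
  · rw [hgt j h, convv_self_of_gt v h]

/-- Corollary 3.4: For a weight sequence `v` with `v 0 = 1`, `v n ≥ 1` and
`∑_{j<n} v j ≤ v n` (`n ≥ 1`), the convolution `conv_v` satisfies:
(1) each `conv_v n n` (`n ≥ 1`) is a probability (nonnegative, total mass `1`);
(2) `conv_v` is associative;
(3) `0 ∈ supp (conv_v m n) ↔ m = n`;
(4) `supp (conv_v n n) = {0,…,n−1}` if `v n = ∑_{j<n} v j`, and `= {0,…,n}` if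
`v n > ∑_{j<n} v j`.
Moreover `conv_v` is the unique such associative deformation of `(ℕ, max)` with
`q n 0 = 1 / v n`. -/
theorem convv_spec_and_unique (v : ℕ → ℝ) (hv0 : v 0 = 1) (hv1 : ∀ n, 1 ≤ v n)
    (hvsum : ∀ n : ℕ, 1 ≤ n → ∑ j ∈ Finset.range n, v j ≤ v n) :
    ((∀ n : ℕ, 1 ≤ n → (∀ j, 0 ≤ convv v n n j) ∧ ∑ᶠ j, convv v n n j = 1) ∧
     (∀ m n k t : ℕ,
        ∑ᶠ j, convv v m n j * convv v j k t = ∑ᶠ j, convv v n k j * convv v m j t) ∧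
     (∀ m n : ℕ, convv v m n 0 ≠ 0 ↔ m = n) ∧
     (∀ n : ℕ, 1 ≤ n →
        (v n = ∑ j ∈ Finset.range n, v j → {j : ℕ | convv v n n j ≠ 0} = Set.Iio n) ∧
        (∑ j ∈ Finset.range n, v j < v n → {j : ℕ | convv v n n j ≠ 0} = Set.Iic n))) ∧
    (∀ q : ℕ → ℕ → ℝ,
      (∀ n : ℕ, 1 ≤ n → {j : ℕ | q n j ≠ 0}.Finite) →
      (∀ n : ℕ, 1 ≤ n → ∀ j, 0 ≤ q n j) →
      (∀ n : ℕ, 1 ≤ n → ∑ᶠ j, q n j = 1) →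
      (∀ n : ℕ, 1 ≤ n → q n 0 = 1 / v n) →
      ∀ conv : ℕ → ℕ → ℕ → ℝ,
      (∀ n : ℕ, 1 ≤ n → conv n n = q n) →
      (∀ m n : ℕ, (m ≠ n ∨ n = 0) → ∀ j, conv m n j = if j = max m n then 1 else 0) →
      (∀ m n k t : ℕ,
        ∑ᶠ j, conv m n j * conv j k t = ∑ᶠ j, conv n k j * conv m j t) →
      (∀ m n : ℕ, conv m n 0 ≠ 0 ↔ m = n) →
      ∀ n : ℕ, 1 ≤ n → q n = convv v n n) := by
  have hpos (n : ℕ) : 0 < v n := one_pos.trans_le (hv1 n)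
  have hne (n : ℕ) : v n ≠ 0 := (hpos n).ne'
  refine ⟨⟨fun n hn => ⟨convv_self_nonneg hpos (hvsum n hn), finsum_convv_self hv0 (hne n)⟩,
    convv_assoc hv0 hne, convv_apply_zero_ne_zero_iff hv0 hne,
    fun n _ => ⟨fun h => ?_, fun h => ?_⟩⟩,
    fun q _ _ hq1 hq0 conv hdiag hoff hassoc _ n hn =>
      eq_convv_of_assoc hv0 hne hq1 hq0 hdiag hoff hassoc hn⟩
  · ext j
    simp [convv_self_ne_zero_iff hv0 hne, ← h]
  · ext j
    simp [convv_self_ne_zero_iff hv0 hne, h.ne', le_iff_lt_or_eq]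
end

section
/- For every k ∈ ℕ, the function χ_k is a character of the deformed hypergroup (ℕ,conv_v): χ_k(0) = 1; for all m,n ∈ ℕ with m ≠ n, χ_k(max(m,n)) = χ_k(m)·χ_k(n); and for every n ≥ 1, χ_k(n)² = ∑_{j=0}^{n} conv_v(n,n)(j)·χ_k(j). -/
/-- `β k = −(∑_{j ≤ k} v j) / v (k+1)`. -/
noncomputable def betav (v : ℕ → ℝ) (k : ℕ) : ℝ :=
  -(∑ j ∈ Finset.range (k + 1), v j) / v (k + 1)

/-- The function `χ_k : ℕ → ℝ`: equal to `1` on `{0,…,k}`, `β k` at `k+1`, `0` above. -/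
noncomputable def chiv (v : ℕ → ℝ) (k n : ℕ) : ℝ :=
  if n ≤ k then 1 else if n = k + 1 then betav v k else 0

theorem chiv_of_le (v : ℕ → ℝ) {k n : ℕ} (h : n ≤ k) : chiv v k n = 1 := if_pos h

theorem chiv_succ_self (v : ℕ → ℝ) (k : ℕ) : chiv v k (k + 1) = betav v k := by
  simp [chiv]

theorem chiv_of_lt (v : ℕ → ℝ) {k n : ℕ} (h : k + 1 < n) : chiv v k n = 0 := by
  rw [chiv, if_neg (by omega), if_neg (by omega)]

theorem chiv_mul_of_lt (v : ℕ → ℝ) (k : ℕ) {m n : ℕ} (h : m < n) :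
    chiv v k m * chiv v k n = chiv v k n := by
  rcases Nat.lt_or_ge (k + 1) n with hn | hn
  · rw [chiv_of_lt v hn, mul_zero]
  · rw [chiv_of_le v (by omega : m ≤ k), one_mul]

theorem sum_convv_self_mul (v f : ℕ → ℝ) {n : ℕ} (hn : n ≠ 0) :
    ∑ j ∈ Finset.range (n + 1), convv v n n j * f j =
      (∑ j ∈ Finset.range n, v j * f j) / v n +
        (v n - ∑ j ∈ Finset.range n, v j) / v n * f n := by
  rw [Finset.sum_range_succ, Finset.sum_div]
  congr 1
  · refine Finset.sum_congr rfl fun j hj => ?_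
    simp [convv, hn, Finset.mem_range.mp hj, div_mul_eq_mul_div]
  · simp [convv, hn]

theorem sum_range_mul_chiv_of_le (v : ℕ → ℝ) {k n : ℕ} (h : n ≤ k + 1) :
    ∑ j ∈ Finset.range n, v j * chiv v k j = ∑ j ∈ Finset.range n, v j := by
  refine Finset.sum_congr rfl fun j hj => ?_
  have := Finset.mem_range.mp hj
  rw [chiv_of_le v (by omega : j ≤ k), mul_one]

theorem sum_range_mul_chiv_of_lt (v : ℕ → ℝ) {k n : ℕ} (hv : v (k + 1) ≠ 0) (h : k + 1 < n) :
    ∑ j ∈ Finset.range n, v j * chiv v k j = 0 := by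
  induction n, h using Nat.le_induction with
  | base =>
    rw [Finset.sum_range_succ, sum_range_mul_chiv_of_le v le_rfl, chiv_succ_self, betav]
    field_simp
    ring
  | succ n hn ih => rw [Finset.sum_range_succ, ih, chiv_of_lt v hn, mul_zero, add_zero]

/-- Theorem 3.6 (first part): each `χ_k` is a character of the deformed hypergroup
`(ℕ, conv_v)`: `χ_k 0 = 1`, `χ_k (max m n) = χ_k m * χ_k n` for `m ≠ n`, and
`(χ_k n)² = ∑_{j=0}^{n} conv_v n n j * χ_k j` for `n ≥ 1`. -/
theorem chiv_is_character (v : ℕ → ℝ) (hv0 : v 0 = 1) (hv1 : ∀ n, 1 ≤ v n)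
    (hvsum : ∀ n : ℕ, 1 ≤ n → ∑ j ∈ Finset.range n, v j ≤ v n) (k : ℕ) :
    chiv v k 0 = 1 ∧
    (∀ m n : ℕ, m ≠ n → chiv v k (max m n) = chiv v k m * chiv v k n) ∧
    (∀ n : ℕ, 1 ≤ n →
      (chiv v k n) ^ 2 = ∑ j ∈ Finset.range (n + 1), convv v n n j * chiv v k j) := by
  have hv : ∀ n, v n ≠ 0 := fun n => (zero_lt_one.trans_le (hv1 n)).ne'
  refine ⟨chiv_of_le v k.zero_le, fun m n hmn => ?_, fun n hn => ?_⟩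
  · rcases lt_or_gt_of_ne hmn with h | h
    · rw [max_eq_right h.le, chiv_mul_of_lt v k h]
    · rw [max_eq_left h.le, mul_comm, chiv_mul_of_lt v k h]
  · rw [sum_convv_self_mul v _ (by omega)]
    have hvn := hv n
    rcases lt_trichotomy n (k + 1) with h | rfl | h
    · rw [sum_range_mul_chiv_of_le v h.le, chiv_of_le v (by omega : n ≤ k)]
      field_simp
      ring
    · rw [sum_range_mul_chiv_of_le v le_rfl, chiv_succ_self, betav]
      field_simp
      ring
    · rw [sum_range_mul_chiv_of_lt v (hv _) h, chiv_of_lt v h]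
      simp
end

section
/- Let χ : ℕ → ℂ be a function, not identically zero, such that χ(max(m,n)) = χ(m)·χ(n) for all m,n ∈ ℕ with m ≠ n, and χ(n)² = ∑_{j=0}^{n} conv_v(n,n)(j)·χ(j) for every n ≥ 1. Then either χ is identically 1, or there exists k ∈ ℕ such that χ = χ_k (in particular χ is real-valued). -/
/-- Theorem 3.6 (second part): every nonzero character `χ : ℕ → ℂ` of the deformed
hypergroup `(ℕ, conv_v)` is either identically `1` or equal to some `χ_k`
(in particular it is real-valued). -/
theorem character_eq_chiv (v : ℕ → ℝ) (hv0 : v 0 = 1) (hv1 : ∀ n, 1 ≤ v n)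
    (hvsum : ∀ n : ℕ, 1 ≤ n → ∑ j ∈ Finset.range n, v j ≤ v n)
    (χ : ℕ → ℂ) (hχ_ne : ∃ n : ℕ, χ n ≠ 0)
    (hχ_mul : ∀ m n : ℕ, m ≠ n → χ (max m n) = χ m * χ n)
    (hχ_diag : ∀ n : ℕ, 1 ≤ n →
      (χ n) ^ 2 = ∑ j ∈ Finset.range (n + 1), (convv v n n j : ℂ) * χ j) :
    (∀ n : ℕ, χ n = 1) ∨ (∃ k : ℕ, ∀ n : ℕ, χ n = (chiv v k n : ℂ)) := by
  have h_lt : ∀ m n, m < n → χ n = χ m * χ n := fun m n h => by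
    simpa [max_eq_right h.le] using hχ_mul m n h.ne
  have hv_ne : ∀ n, (v n : ℂ) ≠ 0 := fun n => by
    exact_mod_cast (zero_lt_one.trans_le (hv1 n)).ne'
  have h_diag : ∀ n, 1 ≤ n → (v n : ℂ) * χ n ^ 2 =
      ∑ j ∈ Finset.range n, (v j : ℂ) * χ j
        + ((v n : ℂ) - ∑ j ∈ Finset.range n, (v j : ℂ)) * χ n := fun n hn => by
    have h_sum : ∑ j ∈ Finset.range n, (convv v n n j : ℂ) * χ j =
        (∑ j ∈ Finset.range n, (v j : ℂ) * χ j) / v n := by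
      rw [Finset.sum_div]
      refine Finset.sum_congr rfl fun j hj => ?_
      simp only [convv, Finset.mem_range.mp hj, if_true, true_and,
        if_pos (Nat.one_le_iff_ne_zero.mp hn)]
      push_cast
      ring
    have h_last : (convv v n n n : ℂ) =
        ((v n : ℂ) - ∑ j ∈ Finset.range n, (v j : ℂ)) / v n := by
      simp [convv, Nat.one_le_iff_ne_zero.mp hn]
    rw [hχ_diag n hn, Finset.sum_range_succ, h_sum, h_last]
    have := hv_ne n
    field_simp
  have h_zero : χ 0 = 1 := by
    by_cases h : ∃ n, 1 ≤ n ∧ χ n ≠ 0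
    · obtain ⟨n, hn, hne⟩ := h
      exact mul_right_cancel₀ hne (by rw [← h_lt 0 n hn, one_mul])
    · push Not at h
      have h1 := h_diag 1 le_rfl
      simp [h 1 le_rfl, hv0] at h1
      obtain ⟨n, hn⟩ := hχ_ne
      rcases Nat.eq_zero_or_pos n with rfl | hpos
      · exact absurd h1 (by simpa [eq_comm] using hn)
      · exact absurd (h n hpos) hn
  by_cases h_all : ∀ n, χ n = 1
  · exact Or.inl h_all
  right
  push Not at h_all
  classical
  obtain ⟨N, hN, h_min⟩ : ∃ N, χ N ≠ 1 ∧ ∀ m < N, χ m = 1 :=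
    ⟨Nat.find h_all, Nat.find_spec h_all, fun m hm => not_not.mp (Nat.find_min h_all hm)⟩
  obtain _ | k := N
  · exact absurd h_zero hN
  refine ⟨k, fun n => ?_⟩
  rcases lt_trichotomy n (k + 1) with hn | rfl | hn
  · simp [chiv, Nat.lt_succ_iff.mp hn, h_min n hn]
  · have h_eq := h_diag (k + 1) (by omega)
    have h_sum : ∑ j ∈ Finset.range (k + 1), (v j : ℂ) * χ j =
        ∑ j ∈ Finset.range (k + 1), (v j : ℂ) :=
      Finset.sum_congr rfl fun j hj => by rw [h_min j (Finset.mem_range.mp hj), mul_one]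
    rw [h_sum] at h_eq
    have h_val : (chiv v k (k + 1) : ℂ) =
        -(∑ j ∈ Finset.range (k + 1), (v j : ℂ)) / v (k + 1) := by
      simp only [chiv, betav, if_neg (Nat.not_succ_le_self k), if_true]
      push_cast
      rfl
    rw [h_val, eq_div_iff (hv_ne _)]
    refine mul_left_cancel₀ (sub_ne_zero.mpr hN) ?_
    linear_combination h_eq
  · have h_prod : (χ (k + 1) - 1) * χ n = 0 := by
      linear_combination -h_lt (k + 1) n hn
    rw [(mul_eq_zero.mp h_prod).resolve_left (sub_ne_zero.mpr hN)]
    simp [chiv, show ¬ n ≤ k by omega, show n ≠ k + 1 by omega]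
end

section
/- For every m ∈ ℕ: γ^m_j ≥ 0 for all j ∈ ℕ; for every p ≥ 1, 0 < −γ^m_{m+p}·β_{m+p} ≤ (1/2)^p; and the series ∑_{j=0}^{∞} γ^m_j converges with sum 1. -/
/-- `γ^m_j`: zero for `j < m`, `1 + β m` at `j = m`, and
`∏_{i=m}^{j−1} (−β i)/(1 − β (i+1))` for `j > m`. -/
noncomputable def gamv (v : ℕ → ℝ) (m j : ℕ) : ℝ :=
  if j < m then 0
  else if j = m then 1 + betav v m
  else ∏ i ∈ Finset.Ico m j, (-(betav v i)) / (1 - betav v (i + 1))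

open Filter Topology in
/-- A nonnegative sequence whose partial sums are `1 - Q p` from `m + 1` on, with `Q → 0`,
sums to `1`. -/
theorem hasSum_one_of_sum_range_eq {f Q : ℕ → ℝ} (m : ℕ) (hf : ∀ j, 0 ≤ f j)
    (hsum : ∀ p, ∑ j ∈ Finset.range (m + p + 1), f j = 1 - Q p)
    (hQ : Tendsto Q atTop (𝓝 0)) : HasSum f 1 := by
  rw [hasSum_iff_tendsto_nat_of_nonneg hf, ← tendsto_add_atTop_iff_nat (m + 1)]
  have h : Tendsto (fun p => 1 - Q p) atTop (𝓝 (1 - 0)) := hQ.const_sub 1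
  rw [sub_zero] at h
  refine h.congr fun p => ?_
  rw [← hsum p]
  congr 2
  ring

theorem betav_neg {v : ℕ → ℝ} (hv1 : ∀ n, 1 ≤ v n) (k : ℕ) : betav v k < 0 := by
  have hpos : ∀ n, 0 < v n := fun n => one_pos.trans_le (hv1 n)
  exact div_neg_of_neg_of_pos
    (neg_neg_of_pos (Finset.sum_pos (fun j _ => hpos j) ⟨0, by simp⟩)) (hpos _)

theorem neg_one_le_betav {v : ℕ → ℝ} (hv1 : ∀ n, 1 ≤ v n)
    (hvsum : ∀ n : ℕ, 1 ≤ n → ∑ j ∈ Finset.range n, v j ≤ v n) (k : ℕ) : -1 ≤ betav v k := by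
  rw [betav, le_div_iff₀ (one_pos.trans_le (hv1 _))]
  linarith [hvsum (k + 1) (by omega)]

/-- The remainder `1 - ∑_{j ≤ m+p} γ^m_j`, in product form. -/
noncomputable def gamvRem (v : ℕ → ℝ) (m p : ℕ) : ℝ :=
  -((∏ i ∈ Finset.Ico m (m + p), (-(betav v i)) / (1 - betav v (i + 1))) * betav v (m + p))

theorem gamvRem_zero (v : ℕ → ℝ) (m : ℕ) : gamvRem v m 0 = -betav v m := by
  simp [gamvRem]

theorem gamv_add_succ (v : ℕ → ℝ) (m p : ℕ) :
    gamv v m (m + (p + 1)) = gamvRem v m p / (1 - betav v (m + p + 1)) := by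
  rw [gamv, if_neg (by omega), if_neg (by omega), ← add_assoc,
    Finset.prod_Ico_succ_top (by omega), gamvRem]
  ring

theorem gamvRem_succ_eq_gamv_mul (v : ℕ → ℝ) (m p : ℕ) :
    gamvRem v m (p + 1) = -(gamv v m (m + (p + 1)) * betav v (m + (p + 1))) := by
  rw [gamv, if_neg (by omega), if_neg (by omega), gamvRem]

theorem gamvRem_succ (v : ℕ → ℝ) (m p : ℕ) :
    gamvRem v m (p + 1) =
      gamvRem v m p * (-betav v (m + p + 1) / (1 - betav v (m + p + 1))) := by
  rw [gamvRem_succ_eq_gamv_mul, gamv_add_succ, ← add_assoc]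
  ring

theorem gamvRem_pos {v : ℕ → ℝ} (hv1 : ∀ n, 1 ≤ v n) (m p : ℕ) : 0 < gamvRem v m p := by
  induction p with
  | zero => simpa [gamvRem_zero] using betav_neg hv1 m
  | succ p ih =>
    have h := betav_neg hv1 (m + p + 1)
    rw [gamvRem_succ]
    exact mul_pos ih (div_pos (by linarith) (by linarith))

theorem gamvRem_le {v : ℕ → ℝ} (hv1 : ∀ n, 1 ≤ v n)
    (hvsum : ∀ n : ℕ, 1 ≤ n → ∑ j ∈ Finset.range n, v j ≤ v n) (m p : ℕ) :
    gamvRem v m p ≤ (1 / 2 : ℝ) ^ p := by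
  induction p with
  | zero =>
    rw [gamvRem_zero, pow_zero]
    linarith [neg_one_le_betav hv1 hvsum m]
  | succ p ih =>
    have h := betav_neg hv1 (m + p + 1)
    have h' := neg_one_le_betav hv1 hvsum (m + p + 1)
    rw [gamvRem_succ, pow_succ]
    refine mul_le_mul ih ?_ (div_nonneg (by linarith) (by linarith)) (by positivity)
    rw [div_le_iff₀ (by linarith)]
    linarith

theorem gamv_nonneg {v : ℕ → ℝ} (hv1 : ∀ n, 1 ≤ v n)
    (hvsum : ∀ n : ℕ, 1 ≤ n → ∑ j ∈ Finset.range n, v j ≤ v n) (m j : ℕ) : 0 ≤ gamv v m j := by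
  rcases lt_trichotomy j m with h | rfl | h
  · simp [gamv, h]
  · simpa [gamv] using by linarith [neg_one_le_betav hv1 hvsum j]
  · obtain ⟨p, rfl⟩ := Nat.exists_eq_add_of_lt h
    rw [add_assoc, gamv_add_succ]
    exact div_nonneg (gamvRem_pos hv1 m p).le (by linarith [betav_neg hv1 (m + p + 1)])

theorem sum_range_gamv {v : ℕ → ℝ} (hv1 : ∀ n, 1 ≤ v n) (m p : ℕ) :
    ∑ j ∈ Finset.range (m + p + 1), gamv v m j = 1 - gamvRem v m p := by
  induction p with
  | zero =>
    rw [add_zero, Finset.sum_range_succ, Finset.sum_eq_zero, gamvRem_zero]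
    · simp [gamv]
    · intro j hj
      simp [gamv, Finset.mem_range.mp hj]
  | succ p ih =>
    have h : 1 - betav v (m + p + 1) ≠ 0 := by linarith [betav_neg hv1 (m + p + 1)]
    rw [Finset.sum_range_succ, ← add_assoc, ih, add_assoc m p 1, gamv_add_succ, gamvRem_succ]
    field_simp
    ring

/-- From the proof of Theorem 3.8: for each `m`, the `γ^m_j` are nonnegative, satisfy
`0 < −γ^m_{m+p} · β_{m+p} ≤ (1/2)^p` for `p ≥ 1`, and sum to `1`. -/
theorem gamv_nonneg_bound_hasSum (v : ℕ → ℝ) (hv0 : v 0 = 1) (hv1 : ∀ n, 1 ≤ v n)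
    (hvsum : ∀ n : ℕ, 1 ≤ n → ∑ j ∈ Finset.range n, v j ≤ v n) (m : ℕ) :
    (∀ j : ℕ, 0 ≤ gamv v m j) ∧
    (∀ p : ℕ, 1 ≤ p →
      0 < -(gamv v m (m + p) * betav v (m + p)) ∧
      -(gamv v m (m + p) * betav v (m + p)) ≤ (1 / 2 : ℝ) ^ p) ∧
    HasSum (fun j : ℕ => gamv v m j) 1 := by
  refine ⟨gamv_nonneg hv1 hvsum m, fun p hp => ?_, ?_⟩
  · obtain ⟨q, rfl⟩ := Nat.exists_eq_add_of_le' hp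
    rw [← gamvRem_succ_eq_gamv_mul]
    exact ⟨gamvRem_pos hv1 m _, gamvRem_le hv1 hvsum m _⟩
  · exact hasSum_one_of_sum_range_eq m (gamv_nonneg hv1 hvsum m) (sum_range_gamv hv1 m)
      (squeeze_zero (fun p => (gamvRem_pos hv1 m p).le) (gamvRem_le hv1 hvsum m)
        (tendsto_pow_atTop_nhds_zero_of_lt_one (by norm_num) (by norm_num)))
end

section
/- Suppose conv is associative. Then for all m,n ∈ E_0(S) with m ≠ n and n ≠ n·m, one has m ∉ Q_n and j·m = n·m for every j ∈ Q_n. -/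
/-- Theorem 4.2(i): With the deformed convolution `conv` on a commutative monoid `S`
(probability measures `q n` on the idempotent diagonal), if `conv` is associative then
for all non-identity idempotents `m ≠ n` with `n ≠ n·m`, one has `m ∉ Qₙ` and
`Qₙ · m = {n·m}`. -/
theorem semiconvo_deformation_support_mul {S : Type*} [CommMonoid S] [DecidableEq S]
    (hE0 : ∃ n : S, n * n = n ∧ n ≠ 1)
    (q : S → S → ℝ)
    (hq_fin : ∀ n : S, n * n = n → n ≠ 1 → {j : S | q n j ≠ 0}.Finite)
    (hq_nonneg : ∀ n : S, n * n = n → n ≠ 1 → ∀ j, 0 ≤ q n j)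
    (hq_sum : ∀ n : S, n * n = n → n ≠ 1 → ∑ᶠ j, q n j = 1)
    (hq_e : ∀ n : S, n * n = n → n ≠ 1 → 0 < q n 1)
    (conv : S → S → S → ℝ)
    (hconv_diag : ∀ n : S, n * n = n → n ≠ 1 → conv n n = q n)
    (hconv_off : ∀ m n : S, ¬(m = n ∧ n * n = n ∧ n ≠ 1) →
      ∀ j, conv m n j = if j = m * n then 1 else 0)
    (hassoc : ∀ m n k t : S,
      ∑ᶠ j, conv m n j * conv j k t = ∑ᶠ j, conv n k j * conv m j t) :
    ∀ m n : S, m * m = m → m ≠ 1 → n * n = n → n ≠ 1 → m ≠ n → n ≠ n * m →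
      q n m = 0 ∧ ∀ j, q n j ≠ 0 → j * m = n * m := by
  intro m n hm hm1 hn hn1 hmn hnm
  have conv_nonneg : ∀ a b t, 0 ≤ conv a b t := by
    intro a b t
    by_cases h : a = b ∧ b * b = b ∧ b ≠ 1
    · obtain ⟨rfl, h1, h2⟩ := h
      rw [hconv_diag a h1 h2]
      exact hq_nonneg a h1 h2 t
    · rw [hconv_off a b h]
      split_ifs <;> norm_num
  -- Associativity at `(n, n, m)`: each term of the left-hand side vanishes away from `n * m`.
  have conv_eq_zero : ∀ j, q n j ≠ 0 → ∀ t, t ≠ n * m → conv j m t = 0 := by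
    intro j hj t ht
    have hleft := hassoc n n m t
    have hright : ∑ᶠ j, conv n m j * conv n j t = 0 := by
      refine finsum_eq_zero_of_forall_eq_zero fun i => ?_
      rw [hconv_off n m (fun h => hmn h.1.symm)]
      split_ifs with hi
      · rw [hi, hconv_off n (n * m) (fun h => hnm h.1), ← mul_assoc, hn, if_neg ht, mul_zero]
      · exact zero_mul _
    rw [hright, hconv_diag n hn hn1] at hleft
    have hle : q n j * conv j m t ≤ ∑ᶠ i, q n i * conv i m t :=
      single_le_finsum (f := fun i => q n i * conv i m t) j
        ((hq_fin n hn hn1).subset fun i hi => left_ne_zero_of_mul hi)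
        fun i => mul_nonneg (hq_nonneg n hn hn1 i) (conv_nonneg i m t)
    have hzero : q n j * conv j m t = 0 :=
      le_antisymm (hle.trans hleft.le)
        (mul_nonneg (hq_nonneg n hn hn1 j) (conv_nonneg j m t))
    exact (mul_eq_zero.mp hzero).resolve_left hj
  have mul_eq : ∀ j, q n j ≠ 0 → j ≠ m → j * m = n * m := by
    intro j hj hjm
    by_contra hne
    have h := conv_eq_zero j hj (j * m) hne
    rw [hconv_off j m (fun h => hjm h.1), if_pos rfl] at h
    exact one_ne_zero h
  have nm_eq : m = n * m := by
    simpa using mul_eq 1 (hq_e n hn hn1).ne' hm1.symm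
  have not_mem : q n m = 0 := by
    by_contra hne
    have h := conv_eq_zero m hne 1 fun h => hm1 (nm_eq.trans h.symm)
    rw [hconv_diag m hm hm1] at h
    exact (hq_e m hm hm1).ne' h
  exact ⟨not_mem, fun j hj => mul_eq j hj fun h => hj (h ▸ not_mem)⟩
end

section
/- Suppose conv is associative and S is inverse-free. Then: (a) for all m,n ∈ E(S), supp(conv(m,n)) ⊆ E(S), and e ∈ supp(conv(m,n)) if and only if m = n; (b) E(S) is max-min type (m·n ∈ {m,n} for m,n ∈ E(S)), and with the linear order on E(S) given by m < n iff m·n = n ≠ m, E(S) is either finite or order-isomorphic to (ℕ,≤); (d) S̃ is an ideal of S: for all m ∈ S̃ and s ∈ S, m·s ∈ S̃. -/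
/-- An infinite linear order whose proper initial segments are finite is order-isomorphic
to `ℕ`. -/
theorem exists_orderIso_nat_of_finite_Iio {α : Type*} [LinearOrder α] [Infinite α]
    (h : ∀ a : α, (Set.Iio a).Finite) : Nonempty (α ≃o ℕ) := by
  have hmono : StrictMono fun a : α => (Set.Iio a).ncard := fun a b hab =>
    Set.ncard_lt_ncard (Set.Iio_ssubset_Iio hab) (h b)
  refine ⟨hmono.orderIsoOfSurjective _ fun k => ?_⟩
  obtain ⟨_, ⟨a, rfl⟩, ha⟩ := (Set.infinite_range_of_injective hmono.injective).exists_gt k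
  have himage : (fun a : α => (Set.Iio a).ncard) '' Set.Iio a = Set.Iio (Set.Iio a).ncard := by
    refine Set.eq_of_subset_of_ncard_le ?_ ?_ (Set.finite_Iio _)
    · rintro _ ⟨b, hb, rfl⟩
      exact hmono hb
    · rw [Set.ncard_image_of_injective _ hmono.injective]
      simp [Set.ncard_eq_toFinset_card']
  obtain ⟨b, -, hb⟩ := himage.ge (Set.mem_Iio.2 ha)
  exact ⟨b, hb⟩

/-- If `c` is an associative, nonnegative, finitely supported convolution, then a point reached by
bracketing to the left is also reached by bracketing to the right. -/
theorem exists_ne_zero_of_finsum_assoc {S : Type*} {c : S → S → S → ℝ}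
    (hnonneg : ∀ m n j, 0 ≤ c m n j) (hfin : ∀ m n, {j | c m n j ≠ 0}.Finite)
    (hassoc : ∀ m n k t, ∑ᶠ j, c m n j * c j k t = ∑ᶠ j, c n k j * c m j t)
    {m n k t j : S} (h₁ : c m n j ≠ 0) (h₂ : c j k t ≠ 0) :
    ∃ i, c n k i ≠ 0 ∧ c m i t ≠ 0 := by
  have hpos : 0 < ∑ᶠ j, c m n j * c j k t :=
    finsum_pos (fun i => mul_nonneg (hnonneg _ _ _) (hnonneg _ _ _))
      ⟨j, mul_pos ((hnonneg _ _ _).lt_of_ne' h₁) ((hnonneg _ _ _).lt_of_ne' h₂)⟩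
      ((hfin m n).subset fun i hi => left_ne_zero_of_mul hi)
  rw [hassoc] at hpos
  by_contra! h
  refine hpos.ne' (finsum_eq_zero_of_forall_eq_zero fun i => ?_)
  exact mul_eq_zero.2 (or_iff_not_imp_left.2 (h i))

/-- The idempotents of a commutative monoid of max-min type, each of which has only finitely many
idempotents below it in the order `a ≤ b ↔ a * b = b`, are finite in number or ordered like `ℕ`. -/
theorem finite_or_exists_bijective_nat_of_maxMin {S : Type*} [CommMonoid S]
    (hmaxmin : ∀ m n : S, m * m = m → n * n = n → (m * n = m ∨ m * n = n))
    (hbelow : ∀ n : S, n * n = n → {m : S | m * m = m ∧ m * n = n ∧ m ≠ n}.Finite) :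
    {x : S | x * x = x}.Finite ∨
      ∃ f : {x : S // x * x = x} → ℕ, Function.Bijective f ∧
        ∀ a b : {x : S // x * x = x}, ((a : S) * b = b ↔ f a ≤ f b) := by
  classical
  refine (Set.finite_or_infinite _).imp_right fun hinf => ?_
  have : Infinite {x : S // x * x = x} := hinf.to_subtype
  let _ : LinearOrder {x : S // x * x = x} :=
    { le := fun a b => (a : S) * b = b
      le_refl := fun a => a.2
      le_trans := fun a b c (hab : (a : S) * b = b) (hbc : (b : S) * c = c) =>
        show (a : S) * c = c by rw [← hbc, ← mul_assoc, hab]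
      le_antisymm := fun a b (hab : (a : S) * b = b) (hba : (b : S) * a = a) =>
        Subtype.ext (by rw [← hba, mul_comm, hab])
      le_total := fun a b => (hmaxmin a b a.2 b.2).symm.imp_right fun h =>
        show (b : S) * a = a by rw [mul_comm, h]
      toDecidableLE := Classical.decRel _ }
  obtain ⟨f⟩ := exists_orderIso_nat_of_finite_Iio (α := {x : S // x * x = x}) fun a =>
    ((hbelow a a.2).preimage Subtype.val_injective.injOn).subset fun b hb =>
      ⟨b.2, hb.le, fun h => hb.ne (Subtype.ext h)⟩
  exact ⟨f, f.bijective, fun a b => f.le_iff_le.symm⟩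


/-- Theorem 4.2(ii)(a),(b),(d): With the deformed convolution `conv` on a commutative
monoid `S` (probability measures `q n` on the idempotent diagonal), if `conv` is
associative and `S` is inverse-free then:
(a) `(E(S), conv)` is a hermitian discrete hypergroup: the convolution of idempotents
is supported in `E(S)`, and `1 ∈ supp (conv m n) ↔ m = n`;
(b) `E(S)` is max-min type and, under the order `m < n ↔ m·n = n ≠ m`, `E(S)` is
finite or order-isomorphic to `(ℕ, ≤)`;
(d) `S̃ = S \ E(S)` is an ideal of `S`. -/
theorem semiconvo_deformation_idempotent_structure {S : Type*} [CommMonoid S]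
    [DecidableEq S]
    (hE0 : ∃ n : S, n * n = n ∧ n ≠ 1)
    (q : S → S → ℝ)
    (hq_fin : ∀ n : S, n * n = n → n ≠ 1 → {j : S | q n j ≠ 0}.Finite)
    (hq_nonneg : ∀ n : S, n * n = n → n ≠ 1 → ∀ j, 0 ≤ q n j)
    (hq_sum : ∀ n : S, n * n = n → n ≠ 1 → ∑ᶠ j, q n j = 1)
    (hq_e : ∀ n : S, n * n = n → n ≠ 1 → 0 < q n 1)
    (conv : S → S → S → ℝ)
    (hconv_diag : ∀ n : S, n * n = n → n ≠ 1 → conv n n = q n)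
    (hconv_off : ∀ m n : S, ¬(m = n ∧ n * n = n ∧ n ≠ 1) →
      ∀ j, conv m n j = if j = m * n then 1 else 0)
    (hassoc : ∀ m n k t : S,
      ∑ᶠ j, conv m n j * conv j k t = ∑ᶠ j, conv n k j * conv m j t)
    (hinv : ∀ m n : S, m * n = 1 → m = 1 ∧ n = 1) :
    (∀ m n : S, m * m = m → n * n = n →
      (∀ j, conv m n j ≠ 0 → j * j = j) ∧ (conv m n 1 ≠ 0 ↔ m = n)) ∧
    ((∀ m n : S, m * m = m → n * n = n → (m * n = m ∨ m * n = n)) ∧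
      ({x : S | x * x = x}.Finite ∨
        ∃ f : {x : S // x * x = x} → ℕ, Function.Bijective f ∧
          ∀ a b : {x : S // x * x = x}, ((a : S) * b = b ↔ f a ≤ f b))) ∧
    (∀ m s : S, ¬(m * m = m) → ¬((m * s) * (m * s) = m * s)) := by
  have hnonneg : ∀ m n j, 0 ≤ conv m n j := by
    intro m n j
    by_cases h : m = n ∧ n * n = n ∧ n ≠ 1
    · obtain ⟨rfl, h₁, h₂⟩ := h
      rw [hconv_diag m h₁ h₂]
      exact hq_nonneg m h₁ h₂ j
    · rw [hconv_off m n h]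
      split_ifs <;> norm_num
  have hsupp : ∀ {m n : S}, ¬(m = n ∧ n * n = n ∧ n ≠ 1) →
      ∀ {j}, conv m n j ≠ 0 ↔ j = m * n := by
    intro m n h j
    simp [hconv_off m n h]
  have hfin : ∀ m n, {j | conv m n j ≠ 0}.Finite := by
    intro m n
    by_cases h : m = n ∧ n * n = n ∧ n ≠ 1
    · obtain ⟨rfl, h₁, h₂⟩ := h
      rw [hconv_diag m h₁ h₂]
      exact hq_fin m h₁ h₂
    · exact (Set.finite_singleton (m * n)).subset fun j hj => (hsupp h).1 hj
  have hassoc_supp {m n k t j : S} (h₁ : conv m n j ≠ 0) (h₂ : conv j k t ≠ 0) :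
      ∃ i, conv n k i ≠ 0 ∧ conv m i t ≠ 0 :=
    exists_ne_zero_of_finsum_assoc hnonneg hfin hassoc h₁ h₂
  have hone : ∀ n : S, n * n = n → n ≠ 1 → conv n n 1 ≠ 0 := by
    intro n h₁ h₂
    rw [hconv_diag n h₁ h₂]
    exact (hq_e n h₁ h₂).ne'
  have hmul : ∀ m n : S, m * m = m → n * n = n → m * n * (m * n) = m * n := by
    intro m n hm hn
    rw [mul_mul_mul_comm, hm, hn]
  have hideal : ∀ m s : S, ¬(m * m = m) → ¬((m * s) * (m * s) = m * s) := by
    intro m s hm hp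
    have hm_off : ∀ s, ¬(m = s ∧ s * s = s ∧ s ≠ 1) := by
      rintro s ⟨rfl, h, -⟩
      exact hm h
    have hm1 : m ≠ 1 := by
      rintro rfl
      simp at hm
    have hp1 : m * s ≠ 1 := fun h => hm1 (hinv _ _ h).1
    obtain ⟨i, -, hi⟩ := hassoc_supp ((hsupp (hm_off s)).2 rfl) (hone _ hp hp1)
    exact hm1 (hinv _ _ ((hsupp (hm_off i)).1 hi).symm).1
  have hmaxmin : ∀ m n : S, m * m = m → n * n = n → (m * n = m ∨ m * n = n) := by
    intro m n hm hn
    by_contra! h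
    obtain ⟨hpm, hpn⟩ := h
    have hmn : m ≠ n := by
      rintro rfl
      exact hpm hm
    have hp1 : m * n ≠ 1 := fun h => hpm (h.trans (hinv _ _ h).1.symm)
    obtain ⟨i, hi, hi'⟩ :=
      hassoc_supp ((hsupp fun h => hmn h.1).2 rfl) (hone _ (hmul m n hm hn) hp1)
    rw [hsupp fun h => hpn h.1.symm, mul_left_comm, hn] at hi
    subst hi
    rw [hsupp fun h => hpm h.1.symm, ← mul_assoc, hm] at hi'
    exact hp1 hi'.symm
  have hsupp_diag : ∀ n : S, n * n = n → n ≠ 1 → ∀ j, conv n n j ≠ 0 → j * j = j := by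
    intro n hn hn1 j hj
    by_contra hjj
    have hoff : ∀ m k : S, ¬(k * k = k) → ¬(m = k ∧ k * k = k ∧ k ≠ 1) :=
      fun m k hk h => hk h.2.1
    have hnj : ¬(n * j * (n * j) = n * j) := by
      rw [mul_comm n j]
      exact hideal j n hjj
    have key : ∀ i, conv n n i ≠ 0 → i * j = n * j := by
      intro i hi
      obtain ⟨l, hl, hl'⟩ := hassoc_supp hi ((hsupp (hoff i j hjj)).2 rfl)
      rw [hsupp (hoff n j hjj)] at hl
      subst hl
      rw [hsupp (hoff n _ hnj), ← mul_assoc, hn] at hl'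
      exact hl'
    have h := key 1 (hone n hn hn1)
    rw [one_mul] at h
    exact hjj ((key j hj).trans h.symm)
  have hbelow : ∀ n : S, n * n = n → {m : S | m * m = m ∧ m * n = n ∧ m ≠ n}.Finite := by
    intro n hn
    by_cases hn1 : n = 1
    · subst hn1
      refine Set.finite_empty.subset fun m hm => hm.2.2 ?_
      simpa using hm.2.1
    · refine (hfin n n).subset fun m ⟨_, hmn, hne⟩ => ?_
      have hm1 : conv 1 m m ≠ 0 := by
        rw [hsupp fun h => h.2.2 h.1.symm, one_mul]
      obtain ⟨i, hi, hi'⟩ := hassoc_supp (hone n hn hn1) hm1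
      rw [hsupp fun h => hne h.1.symm, mul_comm, hmn] at hi
      subst hi
      exact hi'
  refine ⟨fun m n hm hn => ?_, ⟨hmaxmin,
    finite_or_exists_bijective_nat_of_maxMin hmaxmin hbelow⟩, hideal⟩
  by_cases h : m = n ∧ n * n = n ∧ n ≠ 1
  · obtain ⟨rfl, -, h₁⟩ := h
    exact ⟨hsupp_diag m hm h₁, iff_of_true (hone m hm h₁) rfl⟩
  · refine ⟨fun j hj => ?_, ?_⟩
    · rw [(hsupp h).1 hj]
      exact hmul m n hm hn
    · rw [hsupp h]
      refine ⟨fun h₁ => ?_, ?_⟩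
      · obtain ⟨rfl, rfl⟩ := hinv m n h₁.symm
        rfl
      · rintro rfl
        by_contra h₁
        exact h ⟨rfl, hm, fun h₂ => h₁ (by simp [h₂])⟩
end

section
/- Suppose conv is associative and S is inverse-free; order E(S) by m < n iff m·n = n ≠ m, and write 𝓛_n = {j ∈ E(S) : j < n}. Then: (c) if E(S) has more than 2 elements, then for all m,n ∈ E(S) with e ≠ m < n, q_n(e) = q_n(m)·q_m(e) and q_n(e)·(1 + ∑_{k ∈ 𝓛_n, k ≠ e} 1/q_k(e)) ≤ 1; (e) for every n ∈ E_0(S) and every m ∈ S̃, j·m = n·m for all j ∈ Q_n. -/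
/-- Theorem 4.2(ii)(c),(e): With the deformed convolution `conv` on a commutative
monoid `S` (probability measures `q n` on the idempotent diagonal), if `conv` is
associative and `S` is inverse-free then, ordering `E(S)` by `m < n ↔ m·n = n ≠ m`:
(c) if `E(S)` has more than two elements, then for `1 ≠ m < n` in `E(S)`,
`q n 1 = q n m · q m 1` and `q n 1 · (1 + ∑_{1 ≠ k ∈ 𝓛ₙ} 1 / q k 1) ≤ 1`;
(e) for `n ∈ E₀(S)` and `m ∈ S̃ = S \ E(S)`, `Qₙ · m = {n·m}`. -/
theorem semiconvo_deformation_weights {S : Type*} [CommMonoid S] [DecidableEq S]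
    (hE0 : ∃ n : S, n * n = n ∧ n ≠ 1)
    (q : S → S → ℝ)
    (hq_fin : ∀ n : S, n * n = n → n ≠ 1 → {j : S | q n j ≠ 0}.Finite)
    (hq_nonneg : ∀ n : S, n * n = n → n ≠ 1 → ∀ j, 0 ≤ q n j)
    (hq_sum : ∀ n : S, n * n = n → n ≠ 1 → ∑ᶠ j, q n j = 1)
    (hq_e : ∀ n : S, n * n = n → n ≠ 1 → 0 < q n 1)
    (conv : S → S → S → ℝ)
    (hconv_diag : ∀ n : S, n * n = n → n ≠ 1 → conv n n = q n)
    (hconv_off : ∀ m n : S, ¬(m = n ∧ n * n = n ∧ n ≠ 1) →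
      ∀ j, conv m n j = if j = m * n then 1 else 0)
    (hassoc : ∀ m n k t : S,
      ∑ᶠ j, conv m n j * conv j k t = ∑ᶠ j, conv n k j * conv m j t)
    (hinv : ∀ m n : S, m * n = 1 → m = 1 ∧ n = 1) :
    ((∃ a b c : S, a * a = a ∧ b * b = b ∧ c * c = c ∧ a ≠ b ∧ b ≠ c ∧ a ≠ c) →
      ∀ m n : S, m * m = m → n * n = n → m ≠ 1 → m * n = n → m ≠ n →
        q n 1 = q n m * q m 1 ∧
        q n 1 * (1 + ∑ᶠ k ∈ {k : S | k * k = k ∧ k ≠ 1 ∧ k * n = n ∧ k ≠ n},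
          1 / q k 1) ≤ 1) ∧
    (∀ n m : S, n * n = n → n ≠ 1 → ¬(m * m = m) →
      ∀ j, q n j ≠ 0 → j * m = n * m) := by
  have left_eq : ∀ m n t : S, n * n = n → n ≠ 1 → m ≠ n →
      conv (m * n) n t = ∑ᶠ j, q n j * conv m j t := by
    intro m n t hn hn1 hmn
    have h := hassoc m n n t
    rw [hconv_diag n hn hn1, finsum_eq_single _ (m * n)] at h
    · rwa [hconv_off m n (fun h => hmn h.1), if_pos rfl, one_mul] at h
    · intro j hj
      rw [hconv_off m n (fun h => hmn h.1), if_neg hj, zero_mul]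
  have weight_mul : ∀ m n : S, m * m = m → n * n = n → m ≠ 1 → n ≠ 1 → m * n = n → m ≠ n →
      q n 1 = q n m * q m 1 := by
    intro m n hm hn hm1 hn1 hmn hne
    have h := left_eq m n 1 hn hn1 hne
    rw [hmn, hconv_diag n hn hn1, finsum_eq_single _ m] at h
    · rwa [hconv_diag m hm hm1] at h
    · intro j hj
      rw [hconv_off m j (fun h => hj h.1.symm), if_neg (fun h => hm1 (hinv m j h.symm).1),
        mul_zero]
  refine ⟨?_, ?_⟩
  · intro _ m n hm hn hm1 hmn hne
    have hn1 : n ≠ 1 := fun h => hm1 (hinv m n (hmn.trans h)).1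
    refine ⟨weight_mul m n hm hn hm1 hn1 hmn hne, ?_⟩
    have key : ∀ k : S, k ∈ {k : S | k * k = k ∧ k ≠ 1 ∧ k * n = n ∧ k ≠ n} →
        q n k ≠ 0 ∧ q n 1 * (1 / q k 1) = q n k := by
      rintro k ⟨hk, hk1, hkn, hkne⟩
      have h := weight_mul k n hk hn hk1 hn1 hkn hkne
      have hpos := hq_e k hk hk1
      refine ⟨fun h0 => (hq_e n hn hn1).ne' (by rw [h, h0, zero_mul]), ?_⟩
      rw [h]
      field_simp
    have hfin := hq_fin n hn hn1
    have hA := hfin.subset (fun k hk => (key k hk).1)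
    have hsum := hq_sum n hn hn1
    rw [finsum_eq_sum_of_support_subset (s := hfin.toFinset) _
      (fun j hj => by simpa using hj)] at hsum
    rw [finsum_mem_eq_finite_toFinset_sum _ hA, mul_add, mul_one, Finset.mul_sum,
      Finset.sum_congr rfl (fun k hk => (key k (hA.mem_toFinset.1 hk)).2),
      ← Finset.sum_insert (f := q n) (a := 1) (fun h => (hA.mem_toFinset.1 h).2.1 rfl), ← hsum]
    refine Finset.sum_le_sum_of_subset_of_nonneg ?_ (fun j _ _ => hq_nonneg n hn hn1 j)
    intro k hk
    rw [hfin.mem_toFinset]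
    rcases Finset.mem_insert.1 hk with rfl | hk
    · exact (hq_e n hn hn1).ne'
    · exact (key k (hA.mem_toFinset.1 hk)).1
  · intro n m hn hn1 hm j hj
    have hmn : m ≠ n := fun h => hm (h ▸ hn)
    have hm1 : m ≠ 1 := fun h => hm (by rw [h, one_mul])
    have hconv_m : ∀ i t, conv m i t = if t = m * i then 1 else 0 := fun i t =>
      hconv_off m i (fun h => hm (by rw [h.1]; exact h.2.1)) t
    have hne : m * n ≠ n := by
      intro h
      have h1 := left_eq m n 1 hn hn1 hmn
      rw [h, hconv_diag n hn hn1, finsum_eq_zero_of_forall_eq_zero] at h1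
      · exact (hq_e n hn hn1).ne' h1
      · intro i
        rw [hconv_m, if_neg (fun h => hm1 (hinv m i h.symm).1), mul_zero]
    have h := left_eq m n (m * j) hn hn1 hmn
    rw [hconv_off (m * n) n (fun h => hne h.1), mul_assoc, hn] at h
    by_contra hcon
    rw [if_neg (fun h => hcon (by rw [mul_comm j, h, mul_comm])),
      finsum_eq_sum_of_support_subset (s := (hq_fin n hn hn1).toFinset) _
      (fun i hi => by simpa using left_ne_zero_of_mul hi)] at h
    have h0 := (Finset.sum_eq_zero_iff_of_nonneg (fun i _ => mul_nonneg
      (hq_nonneg n hn hn1 i) (by rw [hconv_m]; split_ifs <;> norm_num))).1 h.symm j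
      (by simpa using hj)
    rw [hconv_m, if_pos rfl, mul_one] at h0
    exact hj h0
end

section
/- Suppose S is action-free (every invertible element g of S satisfying g·m = m for all m ∈ E_0(S) equals e) and conv is associative. Then the hermitian hypergroup condition — for all m,n ∈ S, e ∈ supp(conv(m,n)) if and only if m = n — holds if and only if S = E(S), i.e., every element of S is idempotent. -/
/-- Theorem 4.3 (final assertion): Let `(S, ·)` be an action-free commutative monoid
with nonempty `E₀(S)` and associative deformed convolution `conv`. Then `(S, conv)` is
a hermitian discrete hypergroup — i.e. `1 ∈ supp (conv m n) ↔ m = n` for all `m, n` —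
if and only if `S = E(S)`, i.e. every element of `S` is idempotent. -/
theorem semiconvo_hermitian_iff_all_idempotent {S : Type*} [CommMonoid S]
    [DecidableEq S]
    (hE0 : ∃ n : S, n * n = n ∧ n ≠ 1)
    (hact : ∀ g : S, IsUnit g → (∀ m : S, m * m = m → m ≠ 1 → g * m = m) → g = 1)
    (q : S → S → ℝ)
    (hq_fin : ∀ n : S, n * n = n → n ≠ 1 → {j : S | q n j ≠ 0}.Finite)
    (hq_nonneg : ∀ n : S, n * n = n → n ≠ 1 → ∀ j, 0 ≤ q n j)
    (hq_sum : ∀ n : S, n * n = n → n ≠ 1 → ∑ᶠ j, q n j = 1)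
    (hq_e : ∀ n : S, n * n = n → n ≠ 1 → 0 < q n 1)
    (conv : S → S → S → ℝ)
    (hconv_diag : ∀ n : S, n * n = n → n ≠ 1 → conv n n = q n)
    (hconv_off : ∀ m n : S, ¬(m = n ∧ n * n = n ∧ n ≠ 1) →
      ∀ j, conv m n j = if j = m * n then 1 else 0)
    (hassoc : ∀ m n k t : S,
      ∑ᶠ j, conv m n j * conv j k t = ∑ᶠ j, conv n k j * conv m j t) :
    (∀ m n : S, conv m n 1 ≠ 0 ↔ m = n) ↔ (∀ x : S, x * x = x) := by
  have conv_nonneg : ∀ m n j : S, 0 ≤ conv m n j := by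
    intro m n j
    by_cases h : m = n ∧ n * n = n ∧ n ≠ 1
    · obtain ⟨rfl, hm, hm1⟩ := h
      rw [hconv_diag m hm hm1]
      exact hq_nonneg m hm hm1 j
    · rw [hconv_off m n h]
      split_ifs <;> norm_num
  constructor
  · intro herm x
    by_contra hx
    have hxx : x * x = 1 := by
      have h := (herm x x).2 rfl
      rw [hconv_off x x (fun h => hx h.2.1)] at h
      by_contra hne
      exact h (if_neg (Ne.symm hne))
    refine hx ?_
    suffices x = 1 by rw [this, mul_one]
    refine hact x (IsUnit.of_mul_eq_one x hxx) fun m hm hm1 => ?_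
    by_contra hne
    have hxm : x ≠ m := fun h => hx (h ▸ hm)
    have h := hassoc x m m x
    rw [finsum_eq_single _ (x * m) (fun j hj => by
        rw [hconv_off x m (fun h => hxm h.1), if_neg hj, zero_mul]),
      hconv_off x m (fun h => hxm h.1), if_pos rfl, one_mul,
      hconv_off (x * m) m (fun h => hne h.1), mul_assoc, hm,
      if_neg (fun hx' => hm1 (by
        calc m = x * (x * m) := by rw [← mul_assoc, hxx, one_mul]
          _ = 1 := by rw [← hx', hxx])),
      hconv_diag m hm hm1] at h
    have hle := single_le_finsum (f := fun j => q m j * conv x j x) (1 : S)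
      ((hq_fin m hm hm1).subset fun j hj => left_ne_zero_of_mul hj)
      (fun j => mul_nonneg (hq_nonneg m hm hm1 j) (conv_nonneg x j x))
    rw [← h, hconv_off x 1 (fun h => h.2.2 rfl), mul_one, if_pos rfl, mul_one] at hle
    exact (hq_e m hm hm1).not_ge hle
  · intro idem m n
    constructor
    · intro h
      by_contra hmn
      rw [hconv_off m n (fun h => hmn h.1)] at h
      have h1 : m * n = 1 := by
        by_contra hne
        exact h (if_neg (Ne.symm hne))
      have hm : m = 1 := by
        calc m = m * (m * n) := by rw [h1, mul_one]
          _ = 1 := by rw [← mul_assoc, idem, h1]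
      exact hmn (by rw [hm, one_mul] at h1; rw [hm, h1])
    · rintro rfl
      by_cases hm1 : m = 1
      · rw [hconv_off m m (fun h => h.2.2 hm1), idem, if_pos hm1.symm]
        exact one_ne_zero
      · rw [hconv_diag m (idem m) hm1]
        exact (hq_e m (idem m) hm1).ne'
end
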